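/- Let π be a Fano permutation of ZZ_2^3. Then for every nonzero x ∈ ZZ_2^3, ⟨x, π(x)⟩ = 1. -/

import Mathlib

/-- The group `ZZ_2^3`. -/
abbrev V3 := Fin 3 → ZMod 2

/-- A permutation of `ZZ_2^3` is antilinear if it fixes `0` and no three nonzero elements
summing to zero are mapped to three elements summing to zero. -/
def Antilinear (π : Equiv.Perm V3) : Prop :=
  π 0 = 0 ∧ ∀ x y z : V3, x ≠ 0 → y ≠ 0 → z ≠ 0 → x + y + z ≠ 0 ∨ π x + π y + π z ≠ 0

/-- The standard inner product (dot product mod 2) on `ZZ_2^3`. -/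
def dotp (x y : V3) : ZMod 2 := ∑ j, x j * y j

/-- The signature of a permutation of `ZZ_2^3`. -/
def sig (π : Equiv.Perm V3) (x : V3) : V3 :=
  ∑ y ∈ Finset.univ.filter (fun y => dotp x y = 0), π y

/-- A Fano permutation is an antilinear permutation whose signature is the identity. -/
def Fano (π : Equiv.Perm V3) : Prop := Antilinear π ∧ ∀ x, sig π x = x

/-- Identification of `{0,…,7}` with `ZZ_2^3` via binary representation. -/
def ofN (i : Fin 8) : V3 := fun j => if Nat.testBit i.val j.val then 1 else 0

/-- Identification of `ZZ_2^3` with `{0,…,7}` via binary representation. -/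
def toN (x : V3) : Fin 8 :=
  ⟨(x 0).val + 2 * (x 1).val + 4 * (x 2).val, by
    have h0 := ZMod.val_lt (x 0); have h1 := ZMod.val_lt (x 1)
    have h2 := ZMod.val_lt (x 2); omega⟩

/-- The permutation of `ZZ_2^3` described, via the binary identification, by a
table of images of `0,…,7`. -/
noncomputable def permOf (v : Fin 8 → Fin 8) (h : Function.Bijective fun x : V3 => ofN (v (toN x))) :
    Equiv.Perm V3 :=
  Equiv.ofBijective _ h

/-- The finite check: a Fano permutation is determined by the images `a, b, c` of the three
unit vectors, and injectivity (and avoiding `0`) forces the inner products to be one. -/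
theorem fano_finite_check : ∀ a b c : V3,
    ([0, a, b, c, a + b + ![0,0,1], a + c + ![0,1,0], b + c + ![1,0,0],
      a + b + c + ![1,1,1]] : List V3).Nodup →
    dotp ![1,0,0] a = 1 ∧ dotp ![0,1,0] b = 1 ∧ dotp ![0,0,1] c = 1 ∧
    dotp ![1,1,0] (a + b + ![0,0,1]) = 1 ∧ dotp ![1,0,1] (a + c + ![0,1,0]) = 1 ∧
    dotp ![0,1,1] (b + c + ![1,0,0]) = 1 ∧ dotp ![1,1,1] (a + b + c + ![1,1,1]) = 1 := by
  decide +kernel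

theorem V3_add_self (a : V3) : a + a = 0 := by
  funext i
  exact CharTwo.add_self_eq_zero (a i)

/-- The value on the third point of a line. -/
theorem fano_line (π : Equiv.Perm V3) (hπ : Fano π) (n y z w : V3)
    (hf : Finset.univ.filter (fun v => dotp n v = 0) = {0, y, z, w})
    (hd : ([0, y, z, w] : List V3).Nodup) :
    π w = π y + π z + n := by
  have h := hπ.2 n
  unfold sig at h
  simp only [List.nodup_cons, List.mem_cons, List.not_mem_nil, or_false, not_or] at hd
  rw [hf, Finset.sum_insert (by simp; tauto), Finset.sum_insert (by simp; tauto),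
    Finset.sum_insert (by simp; tauto), Finset.sum_singleton, hπ.1.1] at h
  have e : π w = (π y + π y) + (π z + π z) + π w := by simp [V3_add_self]
  rw [e, ← h]
  abel

/-- If `π` is a Fano permutation of `ZZ_2^3` and `x ≠ 0`, then `⟨x, π(x)⟩ = 1`. -/
theorem stmt12 (π : Equiv.Perm V3) (hπ : Fano π) (x : V3) (hx : x ≠ 0) :
    dotp x (π x) = 1 := by
  have h3 := fano_line π hπ ![0,0,1] ![1,0,0] ![0,1,0] ![1,1,0] (by decide +kernel) (by decide +kernel)
  have h2 := fano_line π hπ ![0,1,0] ![1,0,0] ![0,0,1] ![1,0,1] (by decide +kernel) (by decide +kernel)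
  have h1 := fano_line π hπ ![1,0,0] ![0,1,0] ![0,0,1] ![0,1,1] (by decide +kernel) (by decide +kernel)
  have h4 := fano_line π hπ ![0,1,1] ![1,0,0] ![0,1,1] ![1,1,1] (by decide +kernel) (by decide +kernel)
  have e : (![1,0,0] : V3) + ![0,1,1] = ![1,1,1] := by decide +kernel
  have h5 : π ![1,1,1] = π ![1,0,0] + π ![0,1,0] + π ![0,0,1] + ![1,1,1] := by
    rw [h4, h1, ← e]
    abel
  have hn : (([0, ![1,0,0], ![0,1,0], ![0,0,1], ![1,1,0], ![1,0,1], ![0,1,1], ![1,1,1]] :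
      List V3).map π).Nodup := List.Nodup.map π.injective (by decide +kernel)
  simp only [List.map_cons, List.map_nil, hπ.1.1, h1, h2, h3, h5] at hn
  obtain ⟨k1, k2, k3, k4, k5, k6, k7⟩ := fano_finite_check _ _ _ hn
  rw [← h3] at k4
  rw [← h2] at k5
  rw [← h1] at k6
  rw [← h5] at k7
  have hc : ∀ x : V3, x ≠ 0 → x = ![1,0,0] ∨ x = ![0,1,0] ∨ x = ![0,0,1] ∨ x = ![1,1,0] ∨
      x = ![1,0,1] ∨ x = ![0,1,1] ∨ x = ![1,1,1] := by decide +kernel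
  rcases hc x hx with h | h | h | h | h | h | h <;> rw [h] <;> assumption
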